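/- Fix angles α₁, …, α_N ∈ ℝ with sin α_j ≠ 0 for all j, and let M = [[A,B],[C,D]] with A = D = diag(cos α₁, …, cos α_N) and B = −C = diag(sin α₁, …, sin α_N) (a free symplectic matrix). Let f, g : ℝᴺ → ℂ be Schwartz functions. Then the FMT with matrix M (which is the N-dimensional separable fractional Fourier transform F_α) satisfies: the FMT of t ↦ ∫_{ℝᴺ} f(τ) g(t θ τ) dτ equals F_α[f](u) · F_α[g](u) for every u ∈ ℝᴺ, where g(t θ τ) is the M-generalized translation of g. -/

import Mathlib

open MeasureTheory Matrix Complex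

/-- The free metaplectic transform (FMT) of `f : ℝᴺ → ℂ` with respect to the blocks
`A`, `B`, `D` of a free symplectic matrix `M = [[A,B],[C,D]]`:
`L_M[f](u) = |det B|^(−1/2) ∫ f(t) · exp(πi(u D B⁻¹ uᵀ + t B⁻¹ A tᵀ) − 2πi t B⁻¹ uᵀ) dt`. -/
noncomputable def fmt {N : ℕ} (A B D : Matrix (Fin N) (Fin N) ℝ)
    (f : (Fin N → ℝ) → ℂ) (u : Fin N → ℝ) : ℂ :=
  (((Real.sqrt |B.det|)⁻¹ : ℝ) : ℂ) *
    ∫ t : Fin N → ℝ,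
      f t * Complex.exp (↑Real.pi * Complex.I *
          (↑(u ⬝ᵥ ((D * B⁻¹) *ᵥ u)) + ↑(t ⬝ᵥ ((B⁻¹ * A) *ᵥ t)))
        - 2 * ↑Real.pi * Complex.I * ↑(t ⬝ᵥ (B⁻¹ *ᵥ u)))

/-- The `M`-generalized translation of `g` by `τ`:
`g(t θ τ) = |det B|⁻¹ ∫ L_M[g](u) · exp(πi(τ B⁻¹ A τᵀ − t B⁻¹ A tᵀ) + 2πi (t−τ) B⁻¹ uᵀ) du`. -/
noncomputable def genTrans {N : ℕ} (A B D : Matrix (Fin N) (Fin N) ℝ)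
    (g : (Fin N → ℝ) → ℂ) (t τ : Fin N → ℝ) : ℂ :=
  ((|B.det|⁻¹ : ℝ) : ℂ) *
    ∫ u : Fin N → ℝ,
      fmt A B D g u * Complex.exp (↑Real.pi * Complex.I *
          (↑(τ ⬝ᵥ ((B⁻¹ * A) *ᵥ τ)) - ↑(t ⬝ᵥ ((B⁻¹ * A) *ᵥ t)))
        + 2 * ↑Real.pi * Complex.I * ↑((t - τ) ⬝ᵥ (B⁻¹ *ᵥ u)))

open FourierTransform SchwartzMap
open scoped Convolution

/-- The chirp `x ↦ exp(πi x P xᵀ)` on Euclidean space. -/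
noncomputable def chirp {N : ℕ} (P : Matrix (Fin N) (Fin N) ℝ) (x : EuclideanSpace ℝ (Fin N)) : ℂ :=
  Complex.exp (↑Real.pi * Complex.I * ↑(x.ofLp ⬝ᵥ (P *ᵥ x.ofLp)))

theorem hasTemperateGrowth_cexp_mul_I (c : ℝ) :
    Function.HasTemperateGrowth fun r : ℝ => Complex.exp (c * Complex.I * r) := by
  refine ⟨(contDiff_const.mul Complex.ofRealCLM.contDiff).cexp, fun n => ⟨0, |c| ^ n, fun x => ?_⟩⟩
  have h : iteratedDeriv n (fun r : ℝ => Complex.exp (c * Complex.I * r)) =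
      fun r : ℝ => (c * Complex.I) ^ n * Complex.exp (c * Complex.I * r) := by
    induction n with
    | zero => simp
    | succ n ih =>
      rw [iteratedDeriv_succ, ih]
      ext r
      have h₁ : HasDerivAt (fun r : ℝ => c * Complex.I * (r : ℂ)) (c * Complex.I) r := by
        simpa using (Complex.ofRealCLM.hasDerivAt (x := r)).const_mul (c * Complex.I)
      rw [(h₁.cexp.const_mul _).deriv]
      ring
  rw [norm_iteratedFDeriv_eq_norm_iteratedDeriv, h]
  have h₂ : ‖Complex.exp (c * Complex.I * x)‖ = 1 := by
    rw [show (c : ℂ) * Complex.I * x = ↑(c * x) * Complex.I by push_cast; ring,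
      Complex.norm_exp_ofReal_mul_I]
  simp [h₂]

theorem hasTemperateGrowth_chirp {N : ℕ} (P : Matrix (Fin N) (Fin N) ℝ) :
    Function.HasTemperateGrowth (chirp P) := by
  have hq : Function.HasTemperateGrowth
      fun x : EuclideanSpace ℝ (Fin N) => x.ofLp ⬝ᵥ (P *ᵥ x.ofLp) := by
    have hcoord (i : Fin N) : Function.HasTemperateGrowth
        fun x : EuclideanSpace ℝ (Fin N) => x.ofLp i :=
      (EuclideanSpace.proj (𝕜 := ℝ) i).hasTemperateGrowth
    simp only [dotProduct, mulVec]
    refine .sum fun i _ => (hcoord i).mul (.sum fun j _ => ?_)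
    exact (Function.HasTemperateGrowth.const (P i j)).mul (hcoord j)
  exact (hasTemperateGrowth_cexp_mul_I Real.pi).comp hq

/-- A Schwartz function on `ℝᴺ`, transported to Euclidean space and multiplied by a chirp. -/
noncomputable def chirpMul {N : ℕ} (P : Matrix (Fin N) (Fin N) ℝ)
    (f : SchwartzMap (Fin N → ℝ) ℂ) : SchwartzMap (EuclideanSpace ℝ (Fin N)) ℂ :=
  smulLeftCLM ℂ (chirp P)
    (compCLMOfContinuousLinearEquiv ℂ (EuclideanSpace.equiv (Fin N) ℝ) f)

theorem chirpMul_apply {N : ℕ} (P : Matrix (Fin N) (Fin N) ℝ) (f : SchwartzMap (Fin N → ℝ) ℂ)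
    (x : EuclideanSpace ℝ (Fin N)) : chirpMul P f x = chirp P x * f x.ofLp := by
  rw [chirpMul, smulLeftCLM_apply_apply (hasTemperateGrowth_chirp P)]
  rfl

/-- The FMT is a Fourier transform conjugated by chirps. -/
theorem fmt_eq_fourier {N : ℕ} (A B D : Matrix (Fin N) (Fin N) ℝ) (f : (Fin N → ℝ) → ℂ)
    (u : Fin N → ℝ) :
    fmt A B D f u = (((Real.sqrt |B.det|)⁻¹ : ℝ) : ℂ) * chirp (D * B⁻¹) (WithLp.toLp 2 u) *
      𝓕 (fun x : EuclideanSpace ℝ (Fin N) => chirp (B⁻¹ * A) x * f x.ofLp)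
        (WithLp.toLp 2 (B⁻¹ *ᵥ u)) := by
  rw [fmt, mul_assoc (((Real.sqrt |B.det|)⁻¹ : ℝ) : ℂ), Real.fourier_eq', ← integral_const_mul (chirp _ _),
    ← (PiLp.volume_preserving_ofLp (Fin N)).integral_comp
      (MeasurableEquiv.toLp 2 (Fin N → ℝ)).symm.measurableEmbedding]
  congr 2
  refine funext fun x => ?_
  simp only [chirp, smul_eq_mul, EuclideanSpace.inner_eq_star_dotProduct, star_trivial]
  rw [dotProduct_comm (B⁻¹ *ᵥ u), mul_left_comm (Complex.exp (_ * ↑(u ⬝ᵥ _))),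
    ← mul_assoc (Complex.exp _) (Complex.exp _) (f _), ← mul_assoc _ (_ * _) (f _), mul_comm (f _),
    mul_left_comm (Complex.exp _), ← Complex.exp_add, ← Complex.exp_add]
  congr 2
  push_cast
  ring

theorem integral_comp_mulVec {N : ℕ} {B : Matrix (Fin N) (Fin N) ℝ} (hB : B.det ≠ 0)
    (F : (Fin N → ℝ) → ℂ) :
    ∫ w, F (B *ᵥ w) = ((|B.det|⁻¹ : ℝ) : ℂ) * ∫ u, F u := by
  have e : MeasurableEmbedding (Matrix.toLin' B) :=
    (LinearEquiv.ofIsUnitDet (f := Matrix.toLin' B) (v := Pi.basisFun ℝ (Fin N))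
      (v' := Pi.basisFun ℝ (Fin N)) (by simpa using hB)
      ).toContinuousLinearEquiv.toHomeomorph.measurableEmbedding
  have h := e.integral_map (μ := volume) F
  rw [Real.map_matrix_volume_pi_eq_smul_volume_pi hB, integral_smul_measure] at h
  simp only [Matrix.toLin'_apply] at h
  rw [← h, ENNReal.toReal_ofReal (abs_nonneg _), abs_inv, Complex.real_smul]

/-- The generalized translation is an ordinary translation, up to chirps. -/
theorem genTrans_eq_fourierInv {N : ℕ} (A : Matrix (Fin N) (Fin N) ℝ)
    {B : Matrix (Fin N) (Fin N) ℝ} (D : Matrix (Fin N) (Fin N) ℝ) (hB : B.det ≠ 0)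
    (g : (Fin N → ℝ) → ℂ) (x y : EuclideanSpace ℝ (Fin N)) :
    chirp (B⁻¹ * A) x * genTrans A B D g x.ofLp y.ofLp = chirp (B⁻¹ * A) y *
      𝓕⁻ (fun w : EuclideanSpace ℝ (Fin N) => fmt A B D g (B *ᵥ w.ofLp)) (x - y) := by
  rw [genTrans, ← integral_comp_mulVec hB, Real.fourierInv_eq', ← integral_const_mul,
    ← integral_const_mul, ← (PiLp.volume_preserving_ofLp (Fin N)).integral_comp
      (MeasurableEquiv.toLp 2 (Fin N → ℝ)).symm.measurableEmbedding]
  congr 1 with w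
  simp only [chirp, smul_eq_mul, EuclideanSpace.inner_eq_star_dotProduct, star_trivial,
    Matrix.mulVec_mulVec, Matrix.nonsing_inv_mul B hB.isUnit, Matrix.one_mulVec, WithLp.ofLp_sub]
  rw [mul_left_comm, ← Complex.exp_add, ← mul_assoc (Complex.exp _), ← Complex.exp_add, mul_comm]
  congr 2
  push_cast
  ring

theorem fmt_mulVec_eq {N : ℕ} (A : Matrix (Fin N) (Fin N) ℝ)
    {B : Matrix (Fin N) (Fin N) ℝ} (D : Matrix (Fin N) (Fin N) ℝ) (hB : B.det ≠ 0)
    (g : SchwartzMap (Fin N → ℝ) ℂ) :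
    (fun w : EuclideanSpace ℝ (Fin N) => fmt A B D g (B *ᵥ w.ofLp)) =
      ⇑((((Real.sqrt |B.det|)⁻¹ : ℝ) : ℂ) •
        smulLeftCLM ℂ (chirp (Bᵀ * D)) (𝓕 (chirpMul (B⁻¹ * A) g))) := by
  ext w
  rw [fmt_eq_fourier, _root_.smul_apply,
    smulLeftCLM_apply_apply (hasTemperateGrowth_chirp _), SchwartzMap.fourier_coe,
    smul_eq_mul, smul_eq_mul, mul_assoc]
  have hc : chirp (D * B⁻¹) (WithLp.toLp 2 (B *ᵥ w.ofLp)) = chirp (Bᵀ * D) w := by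
    simp only [chirp, Matrix.mulVec_mulVec, Matrix.mul_assoc, Matrix.nonsing_inv_mul B hB.isUnit,
      Matrix.mul_one]
    rw [← Matrix.mulVec_mulVec, Matrix.dotProduct_mulVec w.ofLp, Matrix.vecMul_transpose]
  rw [hc, Matrix.mulVec_mulVec, Matrix.nonsing_inv_mul B hB.isUnit, Matrix.one_mulVec]
  simp only [funext (chirpMul_apply (B⁻¹ * A) g)]

/-- The convolution theorem of the first kind for the free metaplectic transform. -/
theorem fmt_convolution_first_kind {N : ℕ} (A : Matrix (Fin N) (Fin N) ℝ)
    {B : Matrix (Fin N) (Fin N) ℝ} (D : Matrix (Fin N) (Fin N) ℝ) (hB : B.det ≠ 0)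
    (f g : SchwartzMap (Fin N → ℝ) ℂ) (u : Fin N → ℝ) :
    fmt A B D (fun t => ∫ τ : Fin N → ℝ, f τ * genTrans A B D g t τ) u =
      fmt A B D f u * fmt A B D g u := by
  obtain ⟨W, hW⟩ : ∃ W : SchwartzMap (EuclideanSpace ℝ (Fin N)) ℂ,
      (fun w : EuclideanSpace ℝ (Fin N) => fmt A B D g (B *ᵥ w.ofLp)) = ⇑W :=
    ⟨_, fmt_mulVec_eq A D hB g⟩
  have hf : (fun x : EuclideanSpace ℝ (Fin N) => chirp (B⁻¹ * A) x * f x.ofLp) =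
      ⇑(chirpMul (B⁻¹ * A) f) := funext fun x => (chirpMul_apply _ f x).symm
  have hconv : (fun x : EuclideanSpace ℝ (Fin N) => chirp (B⁻¹ * A) x *
      ∫ τ : Fin N → ℝ, f τ * genTrans A B D g x.ofLp τ) =
      (⇑(chirpMul (B⁻¹ * A) f) ⋆[ContinuousLinearMap.mul ℂ ℂ] ⇑(𝓕⁻ W : SchwartzMap (EuclideanSpace ℝ (Fin N)) ℂ)) := by
    ext x
    rw [convolution_def, ← integral_const_mul,
      ← (PiLp.volume_preserving_ofLp (Fin N)).integral_comp
        (MeasurableEquiv.toLp 2 (Fin N → ℝ)).symm.measurableEmbedding]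
    congr 1 with y
    rw [mul_left_comm, genTrans_eq_fourierInv A D hB, hW, ContinuousLinearMap.mul_apply',
      chirpMul_apply, SchwartzMap.fourierInv_coe]
    ring
  have hWu : W (WithLp.toLp 2 (B⁻¹ *ᵥ u)) = fmt A B D g u := by
    rw [← hW]
    simp only [Matrix.mulVec_mulVec, Matrix.mul_nonsing_inv B hB.isUnit, Matrix.one_mulVec]
  rw [fmt_eq_fourier, hconv, Real.fourier_mul_convolution_eq (chirpMul _ f).integrable
    (𝓕⁻ W).integrable, ← SchwartzMap.fourier_coe (𝓕⁻ W), FourierTransform.fourier_fourierInv_eq,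
    hWu, ← mul_assoc, fmt_eq_fourier A B D f u, hf]

/-- Convolution theorem of the first kind for the N-dimensional
separable fractional Fourier transform: with `A = D = diag(cos αⱼ)`,
`B = −C = diag(sin αⱼ)` (and `sin αⱼ ≠ 0`), the FMT of
`t ↦ ∫ f(τ) g(t θ τ) dτ` equals `F_α[f](u) · F_α[g](u)`. -/
theorem frft_convolution_first_kind {N : ℕ} (α : Fin N → ℝ)
    (hα : ∀ j, Real.sin (α j) ≠ 0)
    (f g : SchwartzMap ((Fin N) → ℝ) ℂ) (u : Fin N → ℝ) :
    fmt (Matrix.diagonal fun j => Real.cos (α j))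
        (Matrix.diagonal fun j => Real.sin (α j))
        (Matrix.diagonal fun j => Real.cos (α j))
        (fun t => ∫ τ : Fin N → ℝ,
          f τ * genTrans (Matrix.diagonal fun j => Real.cos (α j))
            (Matrix.diagonal fun j => Real.sin (α j))
            (Matrix.diagonal fun j => Real.cos (α j)) (⇑g) t τ) u
      = fmt (Matrix.diagonal fun j => Real.cos (α j))
          (Matrix.diagonal fun j => Real.sin (α j))
          (Matrix.diagonal fun j => Real.cos (α j)) (⇑f) u *
        fmt (Matrix.diagonal fun j => Real.cos (α j))
          (Matrix.diagonal fun j => Real.sin (α j))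
          (Matrix.diagonal fun j => Real.cos (α j)) (⇑g) u := by
  exact fmt_convolution_first_kind _ _
    (by simpa [Matrix.det_diagonal, Finset.prod_ne_zero_iff] using hα) f g u
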